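/- Let (U, σ) be a catalysis in canonical form: U a unitary on ℂ^{d_A} ⊗ ℂ^{d_B} and σ a density matrix on ℂ^{d_B} with Tr_A(U(ρ ⊗ σ)U†) = σ for every density matrix ρ on ℂ^{d_A}. Write the spectral decomposition σ = ∑_{i=1}^n λ_i Π_i with distinct eigenvalues λ_i and multiplicities r_i = Tr Π_i. Let r be any positive integer, let Û denote the unitary on ℂ^r ⊗ ℂ^{d_A} ⊗ ℂ^{d_B} acting as the identity on the first factor and as U on the last two factors, and for a density matrix ρ on ℂ^r ⊗ ℂ^{d_A} set ω = Tr_B(Û(ρ ⊗ σ)Û†). Then the entropy production is bounded by the catalytic entropy of σ: S(ω) − S(ρ) ≤ S^◇(σ) = −∑_i λ_i r_i log₂(λ_i / r_i) = S(σ) + ∑_i λ_i r_i log₂ r_i. -/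

import Mathlib

open scoped Matrix Kronecker BigOperators Classical ComplexOrder

/-- A density matrix: positive semidefinite with unit trace. -/
noncomputable def IsDensity {n : Type*} [Fintype n] (ρ : Matrix n n ℂ) : Prop :=
  ρ.PosSemidef ∧ ρ.trace = 1

/-- A unitary matrix. -/
noncomputable def IsUnitary {n : Type*} [Fintype n] [DecidableEq n] (U : Matrix n n ℂ) : Prop :=
  U * Uᴴ = 1 ∧ Uᴴ * U = 1

/-- Partial trace over the first tensor factor. -/
noncomputable def trFst {α β : Type*} [Fintype α] (M : Matrix (α × β) (α × β) ℂ) : Matrix β β ℂ :=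
  Matrix.of fun k l => ∑ i, M (i, k) (i, l)

/-- Partial trace over the second tensor factor. -/
noncomputable def trSnd {α β : Type*} [Fintype β] (M : Matrix (α × β) (α × β) ℂ) : Matrix α α ℂ :=
  Matrix.of fun i j => ∑ k, M (i, k) (j, k)

/-- Partial trace over the third factor of a tripartite system. -/
noncomputable def trThird {α β γ : Type*} [Fintype γ] (M : Matrix (α × β × γ) (α × β × γ) ℂ) :
    Matrix (α × β) (α × β) ℂ :=
  Matrix.of fun p q => ∑ k, M (p.1, p.2, k) (q.1, q.2, k)

/-- von Neumann entropy (base-2), with the convention `0 log 0 = 0`. -/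
noncomputable def vnEntropy {n : Type*} [Fintype n] [DecidableEq n] (ρ : Matrix n n ℂ) : ℝ :=
  if h : ρ.IsHermitian then -∑ i, h.eigenvalues i * Real.logb 2 (h.eigenvalues i) else 0

/-- Largest eigenvalue of a (Hermitian) matrix. -/
noncomputable def maxEig {n : Type*} [Fintype n] [DecidableEq n] (ρ : Matrix n n ℂ) : ℝ :=
  if h : ρ.IsHermitian then ⨆ i, h.eigenvalues i else 0

/-- Min-entropy of a density matrix. -/
noncomputable def minEntropy {n : Type*} [Fintype n] [DecidableEq n] (ρ : Matrix n n ℂ) : ℝ :=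
  -Real.logb 2 (maxEig ρ)

/-- Rényi entropy of order `α` (base 2). -/
noncomputable def renyiEntropy {n : Type*} [Fintype n] [DecidableEq n] (α : ℝ)
    (ρ : Matrix n n ℂ) : ℝ :=
  if h : ρ.IsHermitian then (1 - α)⁻¹ * Real.logb 2 (∑ i, h.eigenvalues i ^ α) else 0

/-- Partial transpose over the first tensor factor. -/
noncomputable def ptFst {α β : Type*} (U : Matrix (α × β) (α × β) ℂ) : Matrix (α × β) (α × β) ℂ :=
  Matrix.of fun p q => U (q.1, p.2) (p.1, q.2)

/-- Swap the two parties of a bipartite matrix. -/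
noncomputable def swapParties {α β : Type*} (U : Matrix (α × β) (α × β) ℂ) : Matrix (β × α) (β × α) ℂ :=
  Matrix.of fun p q => U (p.2, p.1) (q.2, q.1)

/-- `U` is compatible with the catalyst `σ`: there is a unitary `V` on `B` such that
`Tr_A (U (ρ ⊗ σ) U†) = V σ V†` for every density matrix `ρ` on `A`. -/
noncomputable def Compatible {dA dB : ℕ} (U : Matrix (Fin dA × Fin dB) (Fin dA × Fin dB) ℂ)
    (σ : Matrix (Fin dB) (Fin dB) ℂ) : Prop :=
  ∃ V : Matrix (Fin dB) (Fin dB) ℂ, IsUnitary V ∧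
    ∀ ρ : Matrix (Fin dA) (Fin dA) ℂ, IsDensity ρ →
      trFst (U * (ρ ⊗ₖ σ) * Uᴴ) = V * σ * Vᴴ

/-- The unitary `1_m ⊗ U` on `ℂ^m ⊗ ℂ^{dA} ⊗ ℂ^{dB}`, indexed as `(Fin m × Fin dA) × Fin dB`. -/
noncomputable def extUnitary {m dA dB : ℕ} (U : Matrix (Fin dA × Fin dB) (Fin dA × Fin dB) ℂ) :
    Matrix ((Fin m × Fin dA) × Fin dB) ((Fin m × Fin dA) × Fin dB) ℂ :=
  Matrix.of fun p q => if p.1.1 = q.1.1 then U (p.1.2, p.2) (q.1.2, q.2) else 0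

lemma vn_eq {n : Type*} [Fintype n] [DecidableEq n] {ρ : Matrix n n ℂ} (h : ρ.IsHermitian) :
    vnEntropy ρ = (∑ i, Real.negMulLog (h.eigenvalues i)) / Real.log 2 := by
  simp only [vnEntropy, h, dite_true, Real.negMulLog, Real.logb]
  rw [← Finset.sum_neg_distrib, Finset.sum_div]
  exact Finset.sum_congr rfl fun i _ => by ring

lemma spec_ex {n : Type*} [Fintype n] [DecidableEq n] {A : Matrix n n ℂ} (h : A.IsHermitian) :
    ∃ V : Matrix n n ℂ, V * Vᴴ = 1 ∧ Vᴴ * V = 1 ∧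
      A = V * Matrix.diagonal (fun i => (h.eigenvalues i : ℂ)) * Vᴴ := by
  refine ⟨h.eigenvectorUnitary, ?_, ?_, ?_⟩
  · exact Unitary.coe_mul_star_self h.eigenvectorUnitary
  · exact Unitary.coe_star_mul_self h.eigenvectorUnitary
  · conv_lhs => rw [h.spectral_theorem, Unitary.conjStarAlgAut_apply]
    rfl

lemma roots_sum {n : Type*} [Fintype n] [DecidableEq n] {A : Matrix n n ℂ} (h : A.IsHermitian)
    (F : ℝ → ℝ) :
    (A.charpoly.roots.map (fun z => F z.re)).sum = ∑ i, F (h.eigenvalues i) := by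
  rw [h.roots_charpoly_eq_eigenvalues, Multiset.map_map]
  rfl

lemma gram_sum {n k : Type*} [Fintype n] [DecidableEq n] [Fintype k] [DecidableEq k]
    (W : Matrix n k ℂ) (h1 : (W * Wᴴ).IsHermitian) (h2 : (Wᴴ * W).IsHermitian)
    (F : ℝ → ℝ) (hF : F 0 = 0) :
    ∑ i, F (h1.eigenvalues i) = ∑ i, F (h2.eigenvalues i) := by
  rw [← roots_sum h1, ← roots_sum h2]
  have h := Matrix.charpoly_mul_comm' W Wᴴ
  have h' := congrArg (fun p => (p.roots.map (fun z : ℂ => F z.re)).sum) h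
  rw [Polynomial.roots_mul, Polynomial.roots_mul] at h'
  · simpa [hF, Multiset.map_nsmul, Multiset.sum_nsmul] using h'
  · exact mul_ne_zero (pow_ne_zero _ Polynomial.X_ne_zero) (Matrix.charpoly_monic _).ne_zero
  · exact mul_ne_zero (pow_ne_zero _ Polynomial.X_ne_zero) (Matrix.charpoly_monic _).ne_zero

lemma row_norm {n : Type*} [Fintype n] [DecidableEq n] {V : Matrix n n ℂ} (h : V * Vᴴ = 1) (i : n) :
    ∑ j, ‖V i j‖ ^ 2 = 1 := by
  have := congrFun (congrFun h i) i
  simp only [Matrix.mul_apply, Matrix.conjTranspose_apply, Matrix.one_apply_eq] at this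
  have h2 : ∀ j, V i j * star (V i j) = ((‖V i j‖ ^ 2 : ℝ) : ℂ) := fun j => by
    rw [Complex.star_def, Complex.mul_conj, Complex.normSq_eq_norm_sq]
  simp only [h2] at this
  exact_mod_cast this

lemma col_norm {n : Type*} [Fintype n] [DecidableEq n] {V : Matrix n n ℂ} (h : Vᴴ * V = 1) (i : n) :
    ∑ j, ‖V j i‖ ^ 2 = 1 := by
  have := row_norm (V := Vᴴ) (by simpa using h) i
  simpa using this

/-- diagonal entries have larger entropy -/
lemma diag_ent {n : Type*} [Fintype n] [DecidableEq n] {A : Matrix n n ℂ} (h : A.PosSemidef) :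
    ∑ i, Real.negMulLog (h.1.eigenvalues i) ≤ ∑ i, Real.negMulLog (A i i).re := by
  obtain ⟨V, h1, h2, h3⟩ := spec_ex h.1
  have key : ∀ i, (A i i).re = ∑ j, ‖V i j‖ ^ 2 * h.1.eigenvalues j := by
    intro i
    conv_lhs => rw [h3]
    rw [Matrix.mul_apply]
    simp only [Matrix.mul_diagonal, Matrix.conjTranspose_apply]
    rw [Complex.re_sum]
    refine Finset.sum_congr rfl fun j _ => ?_
    have hz : V i j * star (V i j) = ((‖V i j‖ ^ 2 : ℝ) : ℂ) := by
      rw [Complex.star_def, Complex.mul_conj, Complex.normSq_eq_norm_sq]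
    rw [mul_right_comm, hz, ← Complex.ofReal_mul, Complex.ofReal_re]
  calc ∑ j, Real.negMulLog (h.1.eigenvalues j)
      = ∑ j, (∑ i, ‖V i j‖ ^ 2) * Real.negMulLog (h.1.eigenvalues j) := by
        simp only [col_norm h2, one_mul]
    _ = ∑ i, ∑ j, ‖V i j‖ ^ 2 * Real.negMulLog (h.1.eigenvalues j) := by
        rw [Finset.sum_comm]; simp only [Finset.sum_mul]
    _ ≤ _ := by
        refine Finset.sum_le_sum fun i _ => ?_
        rw [key i]
        have := Real.concaveOn_negMulLog.le_map_sum (t := Finset.univ)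
          (w := fun j => ‖V i j‖ ^ 2) (p := h.1.eigenvalues) (fun _ _ => by positivity)
          (row_norm h1 i) (fun j _ => h.eigenvalues_nonneg j)
        simpa using this

lemma ensemble {n k : Type*} [Fintype n] [DecidableEq n] [Fintype k] [DecidableEq k]
    (W : Matrix n k ℂ) (h1 : (W * Wᴴ).IsHermitian) :
    ∑ i, Real.negMulLog (h1.eigenvalues i) ≤ ∑ j, Real.negMulLog (∑ x, ‖W x j‖ ^ 2) := by
  have h2 := Matrix.posSemidef_conjTranspose_mul_self W
  rw [gram_sum W h1 h2.1 _ Real.negMulLog_zero]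
  refine (diag_ent h2).trans (le_of_eq ?_)
  refine Finset.sum_congr rfl fun j _ => ?_
  congr 1
  simp only [Matrix.mul_apply, Matrix.conjTranspose_apply, Complex.re_sum]
  refine Finset.sum_congr rfl fun x _ => ?_
  rw [mul_comm, Complex.star_def, Complex.mul_conj, Complex.normSq_eq_norm_sq, Complex.ofReal_re]

lemma ent_le_log {ι : Type*} (s : Finset ι) (c : ι → ℝ) (hc : ∀ i, 0 ≤ c i)
    (h1 : ∑ i ∈ s, c i = 1) : ∑ i ∈ s, Real.negMulLog (c i) ≤ Real.log s.card := by
  have hs : 0 < s.card := by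
    rw [Finset.card_pos]
    by_contra h
    rw [Finset.not_nonempty_iff_eq_empty] at h
    simp [h] at h1
  have hN : (0 : ℝ) < s.card := by exact_mod_cast hs
  have hb : ∀ i ∈ s, Real.negMulLog (c i) ≤ c i * Real.log s.card + (1 / (s.card : ℝ) - c i) := by
    intro i _
    rcases (hc i).eq_or_lt with h | h
    · rw [← h]; simp
    · have := Real.log_le_sub_one_of_pos (x := 1 / (s.card * c i)) (by positivity)
      rw [one_div, Real.log_inv, Real.log_mul hN.ne' h.ne'] at this
      have h3 := mul_le_mul_of_nonneg_left this h.le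
      have h4 : c i * ((s.card * c i)⁻¹ - 1) = 1 / (s.card : ℝ) - c i := by
        field_simp
      rw [Real.negMulLog]
      nlinarith
  refine (Finset.sum_le_sum hb).trans (le_of_eq ?_)
  rw [Finset.sum_add_distrib, Finset.sum_sub_distrib, ← Finset.sum_mul, h1]
  simp [hN.ne']

lemma pow_proj {n : ℕ} {β : Type*} [Fintype β] [DecidableEq β] (lam : Fin n → ℝ)
    (P : Fin n → Matrix β β ℂ)
    (hproj : ∀ i, P i * P i = P i)
    (horth : ∀ i j, i ≠ j → P i * P j = 0)
    (hres : ∑ i, P i = 1) (k : ℕ) :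
    (∑ i, (lam i : ℂ) • P i) ^ k = ∑ i, ((lam i : ℂ) ^ k) • P i := by
  induction k with
  | zero => simp [hres]
  | succ k ih =>
    rw [pow_succ, ih, Finset.sum_mul_sum]
    refine Finset.sum_congr rfl fun i _ => ?_
    rw [Finset.sum_eq_single i]
    · rw [smul_mul_smul_comm, hproj, pow_succ]
    · intro j _ hj
      rw [smul_mul_smul_comm, horth i j hj.symm, smul_zero]
    · simp

lemma pow_conj {β : Type*} [Fintype β] [DecidableEq β] (V : Matrix β β ℂ) (s : β → ℂ)
    (h1 : V * Vᴴ = 1) (h2 : Vᴴ * V = 1) (k : ℕ) :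
    (V * Matrix.diagonal s * Vᴴ) ^ k = V * Matrix.diagonal (fun i => s i ^ k) * Vᴴ := by
  induction k with
  | zero => simp [h1]
  | succ k ih =>
    rw [pow_succ, ih]
    calc _ = V * Matrix.diagonal (fun i => s i ^ k) * (Vᴴ * V) * Matrix.diagonal s * Vᴴ := by
          simp only [Matrix.mul_assoc]
      _ = _ := by
        rw [h2, Matrix.mul_one, Matrix.mul_assoc V, Matrix.diagonal_mul_diagonal]
        simp only [pow_succ]

lemma spec_sum {n : ℕ} {β : Type*} [Fintype β] [DecidableEq β] (lam : Fin n → ℝ)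
    (P : Fin n → Matrix β β ℂ) (r : Fin n → ℕ) (σ : Matrix β β ℂ) (hσ : σ.IsHermitian)
    (hdec : σ = ∑ i, (lam i : ℂ) • P i)
    (hproj : ∀ i, P i * P i = P i)
    (horth : ∀ i j, i ≠ j → P i * P j = 0)
    (hres : ∑ i, P i = 1)
    (htr : ∀ i, (P i).trace = (r i : ℂ)) (F : ℝ → ℝ) :
    ∑ b, F (hσ.eigenvalues b) = ∑ i, (r i : ℝ) * F (lam i) := by
  have hk : ∀ k : ℕ, ∑ b, (hσ.eigenvalues b) ^ k = ∑ i, (r i : ℝ) * (lam i) ^ k := by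
    intro k
    obtain ⟨V, h1, h2, h3⟩ := spec_ex hσ
    have e1 : (σ ^ k).trace = ∑ b, (hσ.eigenvalues b : ℂ) ^ k := by
      conv_lhs => rw [h3]
      rw [pow_conj V _ h1 h2, Matrix.trace_mul_comm, ← Matrix.mul_assoc, h2, Matrix.one_mul,
        Matrix.trace_diagonal]
    have e2 : (σ ^ k).trace = ∑ i, (r i : ℂ) * (lam i : ℂ) ^ k := by
      rw [hdec, pow_proj lam P hproj horth hres, Matrix.trace_sum]
      simp [htr, mul_comm]
    have := e1.symm.trans e2
    exact_mod_cast this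
  have hp : ∀ p : Polynomial ℝ,
      ∑ b, p.eval (hσ.eigenvalues b) = ∑ i, (r i : ℝ) * p.eval (lam i) := by
    intro p
    simp only [Polynomial.eval_eq_sum_range, Finset.mul_sum]
    rw [Finset.sum_comm, Finset.sum_comm (s := (Finset.univ : Finset (Fin n)))]
    refine Finset.sum_congr rfl fun k _ => ?_
    rw [← Finset.mul_sum, hk, Finset.mul_sum]
    exact Finset.sum_congr rfl fun i _ => by ring
  let S : Finset ℝ := Finset.univ.image hσ.eigenvalues ∪ Finset.univ.image lam
  have hi : Set.InjOn (id : ℝ → ℝ) S := Function.injective_id.injOn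
  have hS1 : ∀ b, (Lagrange.interpolate S id F).eval (hσ.eigenvalues b) = F (hσ.eigenvalues b) :=
    fun b => Lagrange.eval_interpolate_at_node F hi (i := hσ.eigenvalues b) (by simp [S])
  have hS2 : ∀ b, (Lagrange.interpolate S id F).eval (lam b) = F (lam b) :=
    fun b => Lagrange.eval_interpolate_at_node F hi (i := lam b) (by simp [S])
  have := hp (Lagrange.interpolate S id F)
  simpa only [hS1, hS2] using this

lemma comm_of_canon {dA dB : ℕ} (U : Matrix (Fin dA × Fin dB) (Fin dA × Fin dB) ℂ)
    (hU : IsUnitary U) (σ : Matrix (Fin dB) (Fin dB) ℂ) (hσ : σ.IsHermitian) (hd : 0 < dA)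
    (hcanon : ∀ ρ : Matrix (Fin dA) (Fin dA) ℂ, IsDensity ρ →
      trFst (U * (ρ ⊗ₖ σ) * Uᴴ) = σ) :
    U * ((1 : Matrix (Fin dA) (Fin dA) ℂ) ⊗ₖ σ) = ((1 : Matrix (Fin dA) (Fin dA) ℂ) ⊗ₖ σ) * U := by
  have hd' : (dA : ℂ) ≠ 0 := by exact_mod_cast hd.ne'
  set X := (1 : Matrix (Fin dA) (Fin dA) ℂ) ⊗ₖ σ with hX
  have hXh : Xᴴ = X := by
    rw [hX, Matrix.conjTranspose_kronecker, Matrix.conjTranspose_one, hσ.eq]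
  have h1 : trFst (U * X * Uᴴ) = (dA : ℂ) • σ := by
    have := hcanon ((dA : ℂ)⁻¹ • 1) ⟨by
      refine Matrix.PosSemidef.smul Matrix.PosSemidef.one ?_
      rw [← Complex.ofReal_natCast, ← Complex.ofReal_inv]
      exact_mod_cast (by positivity : (0 : ℝ) ≤ (dA : ℝ)⁻¹), by simp [hd']⟩
    rw [Matrix.smul_kronecker, Matrix.mul_smul, Matrix.smul_mul] at this
    have e : trFst ((dA : ℂ)⁻¹ • (U * X * Uᴴ)) = (dA : ℂ)⁻¹ • trFst (U * X * Uᴴ) := by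
      ext i j
      simp [trFst, Finset.mul_sum]
    rw [e] at this
    rw [← this, smul_smul, mul_inv_cancel₀ hd', one_smul]
  have h2 : ∀ M : Matrix (Fin dA × Fin dB) (Fin dA × Fin dB) ℂ,
      (M * X).trace = (trFst M * σ).trace := by
    intro M
    simp only [Matrix.trace, Matrix.diag, Matrix.mul_apply, trFst, Matrix.of_apply, hX,
      Matrix.kroneckerMap_apply, Fintype.sum_prod_type, Matrix.one_apply, Finset.sum_mul]
    simp only [ite_mul, one_mul, zero_mul, mul_ite, mul_zero]
    have : ∀ x y, (∑ x1 : Fin dA, ∑ x2 : Fin dB,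
        if x1 = x then M (x, y) (x1, x2) * σ x2 y else 0) = ∑ x2, M (x, y) (x, x2) * σ x2 y := by
      intro x y
      rw [Finset.sum_eq_single x] <;> simp +contextual
    simp only [this]
    rw [Finset.sum_comm]
    refine Finset.sum_congr rfl fun y _ => ?_
    rw [Finset.sum_comm]
  have h3 : (U * X * Uᴴ * X).trace = (X * X).trace := by
    rw [h2, h1, h2]
    congr 2
    ext i j
    simp [trFst, hX]
  rw [← sub_eq_zero, ← Matrix.trace_mul_conjTranspose_self_eq_zero_iff]
  rw [Matrix.conjTranspose_sub, Matrix.conjTranspose_mul, Matrix.conjTranspose_mul, hXh]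
  have a1 : (U * X * (X * Uᴴ)).trace = (X * X).trace := by
    rw [Matrix.trace_mul_comm]
    rw [show X * Uᴴ * (U * X) = X * (Uᴴ * U) * X by simp only [Matrix.mul_assoc], hU.2,
      Matrix.mul_one]
  have a2 : (X * U * (Uᴴ * X)).trace = (X * X).trace := by
    rw [show X * U * (Uᴴ * X) = X * (U * Uᴴ) * X by simp only [Matrix.mul_assoc], hU.1,
      Matrix.mul_one]
  have a3 : (U * X * (Uᴴ * X)).trace = (X * X).trace := by
    rw [← h3]; simp only [Matrix.mul_assoc]
  have a4 : (X * U * (X * Uᴴ)).trace = (X * X).trace := by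
    rw [← h3, Matrix.trace_mul_comm (U * X * Uᴴ)]; simp only [Matrix.mul_assoc]
  rw [Matrix.sub_mul, Matrix.mul_sub, Matrix.mul_sub, Matrix.trace_sub, Matrix.trace_sub,
    Matrix.trace_sub, a1, a2, a3, a4]
  ring

lemma ext_eq {m dA dB : ℕ} (U : Matrix (Fin dA × Fin dB) (Fin dA × Fin dB) ℂ) :
    (extUnitary U : Matrix ((Fin m × Fin dA) × Fin dB) ((Fin m × Fin dA) × Fin dB) ℂ) =
      ((1 : Matrix (Fin m) (Fin m) ℂ) ⊗ₖ U).submatrix (Equiv.prodAssoc _ _ _)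
        (Equiv.prodAssoc _ _ _) := by
  ext p q
  simp [extUnitary, Matrix.one_apply]

lemma ext_comm {m dA dB : ℕ} (U : Matrix (Fin dA × Fin dB) (Fin dA × Fin dB) ℂ)
    (σ : Matrix (Fin dB) (Fin dB) ℂ)
    (h : U * ((1 : Matrix (Fin dA) (Fin dA) ℂ) ⊗ₖ σ) = ((1 : Matrix (Fin dA) (Fin dA) ℂ) ⊗ₖ σ) * U) :
    extUnitary U * ((1 : Matrix (Fin m × Fin dA) (Fin m × Fin dA) ℂ) ⊗ₖ σ) =
      ((1 : Matrix (Fin m × Fin dA) (Fin m × Fin dA) ℂ) ⊗ₖ σ) * extUnitary U := by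
  have e : ((1 : Matrix (Fin m × Fin dA) (Fin m × Fin dA) ℂ) ⊗ₖ σ) =
    ((1 : Matrix (Fin m) (Fin m) ℂ) ⊗ₖ ((1 : Matrix (Fin dA) (Fin dA) ℂ) ⊗ₖ σ)).submatrix
      (Equiv.prodAssoc _ _ _) (Equiv.prodAssoc _ _ _) := by
    rw [← Matrix.one_kronecker_one]
    ext p q
    simp only [Matrix.kroneckerMap_apply, Matrix.submatrix_apply, Equiv.prodAssoc_apply, mul_assoc]
  rw [e, ext_eq, Matrix.submatrix_mul_equiv, Matrix.submatrix_mul_equiv,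
    ← Matrix.mul_kronecker_mul, ← Matrix.mul_kronecker_mul, h]

lemma ext_unit {m dA dB : ℕ} (U : Matrix (Fin dA × Fin dB) (Fin dA × Fin dB) ℂ)
    (hU : IsUnitary U) :
    (extUnitary U : Matrix ((Fin m × Fin dA) × Fin dB) ((Fin m × Fin dA) × Fin dB) ℂ)ᴴ *
      extUnitary U = 1 := by
  rw [ext_eq, Matrix.conjTranspose_submatrix, Matrix.submatrix_mul_equiv,
    Matrix.conjTranspose_kronecker, ← Matrix.mul_kronecker_mul, hU.2]
  simp

lemma core {a β : Type*} [Fintype a] [DecidableEq a] [Fintype β] [DecidableEq β]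
    (T : Matrix (a × β) (a × β) ℂ) (hT : Tᴴ * T = 1) (q : a → ℝ) (s : β → ℝ)
    (hq : ∀ j, 0 ≤ q j) (hs : ∀ b, 0 ≤ s b) (hq1 : ∑ j, q j = 1) (hs1 : ∑ b, s b = 1)
    (hTs : ∀ x b' j b, s b' ≠ s b → T (x, b') (j, b) = 0)
    (ω : Matrix a a ℂ) (hω : ω.IsHermitian)
    (hωe : ω = trSnd (T * (Matrix.diagonal (fun j => (q j : ℂ)) ⊗ₖ
      Matrix.diagonal (fun b => (s b : ℂ))) * Tᴴ)) :
    ∑ i, Real.negMulLog (hω.eigenvalues i) ≤ ∑ j, Real.negMulLog (q j) +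
      ∑ b, (Real.negMulLog (s b) +
        s b * Real.log ((Finset.univ.filter (fun b' => s b' = s b)).card : ℝ)) := by
  let W : Matrix a (a × β × β) ℂ :=
    Matrix.of fun x k => (Real.sqrt (q k.1 * s k.2.1) : ℂ) * T (x, k.2.2) (k.1, k.2.1)
  have hW : ω = W * Wᴴ := by
    rw [hωe, Matrix.diagonal_kronecker_diagonal]
    ext x y
    simp only [trSnd, Matrix.of_apply]
    simp only [Matrix.mul_apply (M := T * _), Matrix.mul_apply (M := W), Matrix.mul_diagonal,
      Matrix.conjTranspose_apply, Fintype.sum_prod_type, W, Matrix.of_apply]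
    rw [Finset.sum_comm]
    refine Finset.sum_congr rfl fun j _ => ?_
    rw [Finset.sum_comm]
    refine Finset.sum_congr rfl fun b _ => Finset.sum_congr rfl fun b' _ => ?_
    have h0 : ((Real.sqrt (q j * s b) : ℂ)) * (Real.sqrt (q j * s b) : ℂ) = (q j : ℂ) * s b := by
      rw [← Complex.ofReal_mul, Real.mul_self_sqrt (mul_nonneg (hq j) (hs b)), Complex.ofReal_mul]
    rw [star_mul', Complex.star_def, Complex.conj_ofReal, ← h0]
    ring
  subst hW
  refine (ensemble W hω).trans ?_
  let c : a → β → β → ℝ := fun j b b' => ∑ x, ‖T (x, b') (j, b)‖ ^ 2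
  have hc0 : ∀ j b b', 0 ≤ c j b b' := fun j b b' => Finset.sum_nonneg fun _ _ => by positivity
  have hc1 : ∀ j b, ∑ b', c j b b' = 1 := by
    intro j b
    have := col_norm hT (j, b)
    rw [Fintype.sum_prod_type, Finset.sum_comm] at this
    exact this
  have hcz : ∀ j b b', s b' ≠ s b → c j b b' = 0 := by
    intro j b b' h
    simp [c, hTs _ _ _ _ h]
  have hcE : ∀ j b, ∑ b', Real.negMulLog (c j b b') ≤
      Real.log ((Finset.univ.filter (fun b' => s b' = s b)).card : ℝ) := by
    intro j b
    have e1 : ∑ b' ∈ Finset.univ.filter (fun b' => s b' = s b), c j b b' = 1 := by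
      rw [← hc1 j b]
      refine Finset.sum_subset (Finset.filter_subset _ _) fun b' _ h => hcz j b b' (by simpa using h)
    refine le_trans (le_of_eq ?_) (ent_le_log _ (c j b) (hc0 j b) e1)
    symm
    refine Finset.sum_subset (Finset.filter_subset _ _) fun b' _ h => ?_
    rw [hcz j b b' (by simpa using h), Real.negMulLog_zero]
  have hn : ∀ j b b', ∑ x, ‖W x (j, b, b')‖ ^ 2 = q j * (s b * c j b b') := by
    intro j b b'
    simp only [W, c, Matrix.of_apply, norm_mul, mul_pow, Complex.norm_real, Real.norm_eq_abs,
      sq_abs, Real.sq_sqrt (mul_nonneg (hq j) (hs b)), ← Finset.mul_sum, mul_assoc]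
  simp only [Fintype.sum_prod_type, hn]
  have step : ∀ j, ∑ b, ∑ b', Real.negMulLog (q j * (s b * c j b b')) ≤
      Real.negMulLog (q j) + q j * ∑ b, (Real.negMulLog (s b) +
        s b * Real.log ((Finset.univ.filter (fun b' => s b' = s b)).card : ℝ)) := by
    intro j
    have e : ∀ b, ∑ b', Real.negMulLog (q j * (s b * c j b b')) =
        s b * Real.negMulLog (q j) + q j * (Real.negMulLog (s b) +
          s b * ∑ b', Real.negMulLog (c j b b')) := by
      intro b
      have e' : ∀ b', Real.negMulLog (q j * (s b * c j b b')) =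
        (s b * Real.negMulLog (q j) + q j * Real.negMulLog (s b)) * c j b b' +
          (q j * s b) * Real.negMulLog (c j b b') := by
        intro b'
        rw [Real.negMulLog_mul, Real.negMulLog_mul]; ring
      simp only [e', Finset.sum_add_distrib, ← Finset.mul_sum, hc1]
      ring
    simp only [e, Finset.sum_add_distrib, ← Finset.sum_mul, hs1, one_mul, ← Finset.mul_sum]
    have h2 : ∑ b, s b * ∑ b', Real.negMulLog (c j b b') ≤
      ∑ b, s b * Real.log ((Finset.univ.filter (fun b' => s b' = s b)).card : ℝ) :=
      Finset.sum_le_sum fun b _ => mul_le_mul_of_nonneg_left (hcE j b) (hs b)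
    have := mul_le_mul_of_nonneg_left h2 (hq j)
    linarith
  refine (Finset.sum_le_sum fun j _ => step j).trans (le_of_eq ?_)
  rw [Finset.sum_add_distrib, ← Finset.sum_mul, hq1, one_mul]

lemma trSnd_conj {a β : Type*} [Fintype a] [DecidableEq a] [Fintype β] [DecidableEq β]
    (M : Matrix (a × β) (a × β) ℂ) (V : Matrix β β ℂ) (h : V * Vᴴ = 1) :
    trSnd (((1 : Matrix a a ℂ) ⊗ₖ Vᴴ) * M * ((1 : Matrix a a ℂ) ⊗ₖ V)) = trSnd M := by
  have h1 : ∀ i j, Matrix.of (fun k l =>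
      ((((1 : Matrix a a ℂ) ⊗ₖ Vᴴ) * M * ((1 : Matrix a a ℂ) ⊗ₖ V)) (i, k) (j, l))) =
      Vᴴ * Matrix.of (fun k l => M (i, k) (j, l)) * V := by
    intro i j
    ext k l
    simp only [Matrix.of_apply, Matrix.mul_apply, Fintype.sum_prod_type, Matrix.kroneckerMap_apply,
      Matrix.one_apply, ite_mul, one_mul, zero_mul, mul_ite, mul_zero]
    rw [Finset.sum_eq_single j]
    · refine Finset.sum_congr rfl fun y _ => ?_
      rw [Finset.sum_eq_single i]
      · simp
      · intro b _ hb; simp [hb.symm]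
      · simp
    · intro b _ hb; simp [hb]
    · simp
  ext i j
  have e1 : ∀ N : Matrix (a × β) (a × β) ℂ, trSnd N i j =
    (Matrix.of (fun k l => N (i, k) (j, l))).trace := fun N => rfl
  rw [e1, e1, h1, Matrix.trace_mul_comm, ← Matrix.mul_assoc, h, Matrix.one_mul]

lemma sum_eig {n : Type*} [Fintype n] [DecidableEq n] {A : Matrix n n ℂ} (h : A.IsHermitian)
    (ht : A.trace = 1) : ∑ i, h.eigenvalues i = 1 := by
  have := h.trace_eq_sum_eigenvalues
  rw [ht] at this
  have h2 := congrArg Complex.re this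
  simpa using h2.symm

lemma trSnd_herm {a β : Type*} [Fintype β] {M : Matrix (a × β) (a × β) ℂ} (h : M.IsHermitian) :
    (trSnd M).IsHermitian := by
  ext i j
  simp only [trSnd, Matrix.conjTranspose_apply, Matrix.of_apply, star_sum]
  exact Finset.sum_congr rfl fun k _ => h.apply _ _

/-- Theorem 5: the entropy production of a catalysis is bounded by the catalytic entropy
`S^◇(σ) = −∑ λᵢ rᵢ log₂(λᵢ/rᵢ) = S(σ) + ∑ λᵢ rᵢ log₂ rᵢ` of the catalyst. -/
theorem stmt10 {dA dB : ℕ} (U : Matrix (Fin dA × Fin dB) (Fin dA × Fin dB) ℂ)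
    (hU : IsUnitary U) (σ : Matrix (Fin dB) (Fin dB) ℂ) (hσ : IsDensity σ)
    (hcanon : ∀ ρ : Matrix (Fin dA) (Fin dA) ℂ, IsDensity ρ →
      trFst (U * (ρ ⊗ₖ σ) * Uᴴ) = σ)
    {n : ℕ} (lam : Fin n → ℝ) (P : Fin n → Matrix (Fin dB) (Fin dB) ℂ) (r : Fin n → ℕ)
    (hdec : σ = ∑ i, (lam i : ℂ) • P i)
    (hdist : Function.Injective lam)
    (hproj : ∀ i, (P i).IsHermitian ∧ P i * P i = P i)
    (horth : ∀ i j, i ≠ j → P i * P j = 0)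
    (hres : ∑ i, P i = 1)
    (hrpos : ∀ i, 0 < r i)
    (htr : ∀ i, (P i).trace = (r i : ℂ))
    (m : ℕ) (hm : 0 < m)
    (ρ : Matrix (Fin m × Fin dA) (Fin m × Fin dA) ℂ) (hρ : IsDensity ρ)
    (ω : Matrix (Fin m × Fin dA) (Fin m × Fin dA) ℂ)
    (hω : ω = trSnd ((extUnitary U : Matrix ((Fin m × Fin dA) × Fin dB)
        ((Fin m × Fin dA) × Fin dB) ℂ) * (ρ ⊗ₖ σ) * (extUnitary U)ᴴ)) :
    vnEntropy ω - vnEntropy ρ ≤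
      -∑ i, (lam i * (r i : ℝ)) * Real.logb 2 (lam i / (r i : ℝ)) ∧
    -∑ i, (lam i * (r i : ℝ)) * Real.logb 2 (lam i / (r i : ℝ)) =
      vnEntropy σ + ∑ i, (lam i * (r i : ℝ)) * Real.logb 2 (r i : ℝ) := by
  have hσh := hσ.1.1
  have hρh := hρ.1.1
  have hlog2 : 0 < Real.log 2 := Real.log_pos one_lt_two
  have hsum := spec_sum lam P r σ hσh hdec (fun i => (hproj i).2) horth hres htr
  have hcard : ∀ i, ((Finset.univ.filter (fun b => hσh.eigenvalues b = lam i)).card : ℝ) = r i := by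
    intro i
    have := hsum (fun x => if x = lam i then 1 else 0)
    simpa [hdist.eq_iff] using this
  have hr0 : ∀ i, (r i : ℝ) ≠ 0 := fun i => by exact_mod_cast (hrpos i).ne'
  have hσS := hsum Real.negMulLog
  have hB := hsum (fun x => Real.negMulLog x +
    x * Real.log ((Finset.univ.filter (fun b => hσh.eigenvalues b = x)).card : ℝ))
  simp only [hcard] at hB
  have hmid : -∑ i, (lam i * (r i : ℝ)) * Real.logb 2 (lam i / (r i : ℝ)) =
      (∑ i, (r i : ℝ) * (Real.negMulLog (lam i) + lam i * Real.log (r i))) / Real.log 2 := by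
    rw [← Finset.sum_neg_distrib, Finset.sum_div]
    refine Finset.sum_congr rfl fun i _ => ?_
    by_cases h : lam i = 0
    · simp [h]
    · rw [Real.logb, Real.log_div h (hr0 i), Real.negMulLog]
      ring
  refine ⟨?_, ?_⟩
  · have hd : 0 < dA := by
      rcases Nat.eq_zero_or_pos dA with h | h
      · subst h
        have := hρ.2
        simp [Matrix.trace] at this
      · exact h
    have hcomm := ext_comm (m := m) U σ (comm_of_canon U hU σ hσh hd hcanon)
    have hUe := ext_unit (m := m) U hU
    have hωh : ω.IsHermitian := by
      rw [hω]
      refine trSnd_herm (Matrix.isHermitian_mul_mul_conjTranspose _ ?_)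
      rw [Matrix.IsHermitian, Matrix.conjTranspose_kronecker, hρh.eq, hσh.eq]
    generalize hG : (extUnitary U : Matrix ((Fin m × Fin dA) × Fin dB)
        ((Fin m × Fin dA) × Fin dB) ℂ) = G at *
    obtain ⟨V, hV1, hV2, hV⟩ := spec_ex hσh
    obtain ⟨E, hE1, hE2, hE⟩ := spec_ex hρh
    set Ds := Matrix.diagonal (fun i => (hσh.eigenvalues i : ℂ)) with hDs
    set Dq := Matrix.diagonal (fun i => (hρh.eigenvalues i : ℂ)) with hDq
    let I : Matrix (Fin m × Fin dA) (Fin m × Fin dA) ℂ := 1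
    let T := (I ⊗ₖ Vᴴ) * G * (E ⊗ₖ V)
    have hTh : Tᴴ = (Eᴴ ⊗ₖ Vᴴ) * (Gᴴ * (I ⊗ₖ V)) := by
      simp [T, I, Matrix.conjTranspose_mul, Matrix.conjTranspose_kronecker]
    have hT : Tᴴ * T = 1 := by
      rw [hTh]
      calc _ = (Eᴴ ⊗ₖ Vᴴ) * (Gᴴ * ((I ⊗ₖ V) * (I ⊗ₖ Vᴴ)) * G) * (E ⊗ₖ V) := by
            simp only [T, Matrix.mul_assoc]
        _ = 1 := by
            rw [← Matrix.mul_kronecker_mul, hV1]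
            simp only [I, Matrix.one_mul, Matrix.one_kronecker_one, Matrix.mul_one, hUe]
            rw [← Matrix.mul_kronecker_mul, hE2, hV2, Matrix.one_kronecker_one]
    have hTc : (I ⊗ₖ Ds) * T = T * (I ⊗ₖ Ds) := by
      have f1 : (I ⊗ₖ Ds) * (I ⊗ₖ Vᴴ) = (I ⊗ₖ Vᴴ) * (I ⊗ₖ σ) := by
        rw [← Matrix.mul_kronecker_mul, ← Matrix.mul_kronecker_mul, hV, ← Matrix.mul_assoc,
          ← Matrix.mul_assoc, hV2, Matrix.one_mul Ds]
      have f2 : (E ⊗ₖ V) * (I ⊗ₖ Ds) = (I ⊗ₖ σ) * (E ⊗ₖ V) := by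
        rw [← Matrix.mul_kronecker_mul, ← Matrix.mul_kronecker_mul, hV, Matrix.mul_assoc,
          hV2, Matrix.mul_one]
        simp [I]
      calc _ = ((I ⊗ₖ Ds) * (I ⊗ₖ Vᴴ)) * G * (E ⊗ₖ V) := by simp only [T, Matrix.mul_assoc]
        _ = (I ⊗ₖ Vᴴ) * ((I ⊗ₖ σ) * G) * (E ⊗ₖ V) := by rw [f1]; simp only [Matrix.mul_assoc]
        _ = (I ⊗ₖ Vᴴ) * G * ((I ⊗ₖ σ) * (E ⊗ₖ V)) := by
            rw [← hcomm]; simp only [Matrix.mul_assoc, I]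
        _ = _ := by rw [← f2]; simp only [T, Matrix.mul_assoc]
    have hTs : ∀ x b' j b, hσh.eigenvalues b' ≠ hσh.eigenvalues b → T (x, b') (j, b) = 0 := by
      intro x b' j b hne
      have h := congrFun (congrFun hTc (x, b')) (j, b)
      have hI : I ⊗ₖ Ds = Matrix.diagonal (fun p : (Fin m × Fin dA) × Fin dB =>
          (hσh.eigenvalues p.2 : ℂ)) := by
        rw [hDs, show I = Matrix.diagonal (fun _ => (1 : ℂ)) from Matrix.diagonal_one.symm,
          Matrix.diagonal_kronecker_diagonal]
        simp
      rw [hI, Matrix.diagonal_mul, Matrix.mul_diagonal] at h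
      have h' : ((hσh.eigenvalues b' : ℂ) - hσh.eigenvalues b) * T (x, b') (j, b) = 0 := by
        rw [sub_mul, h]; ring
      rcases mul_eq_zero.1 h' with h'' | h''
      · exact absurd (by exact_mod_cast sub_eq_zero.1 h'') hne
      · exact h''
    have hωe : ω = trSnd (T * (Dq ⊗ₖ Ds) * Tᴴ) := by
      have : T * (Dq ⊗ₖ Ds) * Tᴴ = (I ⊗ₖ Vᴴ) * (G * (ρ ⊗ₖ σ) * Gᴴ) * (I ⊗ₖ V) := by
        have hk : ρ ⊗ₖ σ = (E ⊗ₖ V) * (Dq ⊗ₖ Ds) * (Eᴴ ⊗ₖ Vᴴ) := by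
          rw [← Matrix.mul_kronecker_mul, ← Matrix.mul_kronecker_mul, ← hE, ← hV]
        rw [hk, hTh]
        simp only [T, Matrix.mul_assoc]
      rw [this, hω]
      exact (trSnd_conj _ V hV1).symm
    have := core T hT hρh.eigenvalues hσh.eigenvalues hρ.1.eigenvalues_nonneg
      hσ.1.eigenvalues_nonneg (sum_eig hρh hρ.2) (sum_eig hσh hσ.2) hTs ω hωh hωe
    rw [hmid, vn_eq hωh, vn_eq hρh, ← sub_div]
    refine div_le_div_of_nonneg_right ?_ hlog2.le
    have e2 : ∑ b, (Real.negMulLog (hσh.eigenvalues b) + hσh.eigenvalues b *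
      Real.log ((Finset.univ.filter
        (fun b' => hσh.eigenvalues b' = hσh.eigenvalues b)).card : ℝ)) = _ := hB
    linarith
  · rw [hmid, vn_eq hσh, hσS]
    simp only [mul_add, Finset.sum_add_distrib, add_div]
    congr 1
    rw [Finset.sum_div]
    refine Finset.sum_congr rfl fun i _ => ?_
    rw [Real.logb]
    ring
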